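/- Pointwise convergence of the backward averaging operator: Let d ∈ (0,1), f ∈ SD²_{d−1}(0+), g_δ(t,v) = [f(t+δ,t−δv) − f(t,t−δv)]/f(t+δ,t), and let X : [0,∞) → ℝ be a càdlàg path with X(0) = X(0−) = 0 which is bounded on [0,1]. Then for every t ∈ [0,1], lim_{δ↓0} | ∫₀^{t/δ} g_δ(t,v) X(t−δv) dv + (1/d) X(t−) | = 0. -/

import Mathlib

open MeasureTheory ProbabilityTheory Filter Set intervalIntegral Real

/-- `p01 F t r = ∂F/∂r (t,r)` -/
noncomputable def p01 (F : ℝ → ℝ → ℝ) (t r : ℝ) : ℝ := deriv (fun x => F t x) r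
/-- `p10 F t r = ∂F/∂t (t,r)` -/
noncomputable def p10 (F : ℝ → ℝ → ℝ) (t r : ℝ) : ℝ := deriv (fun x => F x r) t
/-- `p11 F t r = ∂²F/∂t∂r (t,r)` -/
noncomputable def p11 (F : ℝ → ℝ → ℝ) (t r : ℝ) : ℝ := deriv (fun x => p01 F x r) t
/-- `p02 F t r = ∂²F/∂r² (t,r)` -/
noncomputable def p02 (F : ℝ → ℝ → ℝ) (t r : ℝ) : ℝ := deriv (fun x => p01 F t x) r

/-- `lim_{h↓0} sup_{t∈K} |G h t + c| = 0` for every compact `K ⊂ ℝ`. -/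
def UnifDiagLimit (G : ℝ → ℝ → ℝ) (c : ℝ) : Prop :=
  ∀ K : Set ℝ, IsCompact K → ∀ ε > 0, ∃ h₀ > 0, ∀ h : ℝ, 0 < h → h < h₀ →
    ∀ t ∈ K, |G h t + c| < ε

/-- `F ∈ SR²_ρ(0+)` : a function of smooth variation of index `ρ` at the diagonal. -/
def SmoothVar (F : ℝ → ℝ → ℝ) (ρ : ℝ) : Prop :=
  ContinuousOn (fun p : ℝ × ℝ => F p.1 p.2) {p : ℝ × ℝ | p.2 ≤ p.1} ∧
  ContDiffOn ℝ 2 (fun p : ℝ × ℝ => F p.1 p.2) {p : ℝ × ℝ | p.2 < p.1} ∧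
  (∀ t r : ℝ, r < t → 0 < F t r) ∧
  UnifDiagLimit (fun h t => h * p01 F t (t - h) / F t (t - h)) ρ ∧
  UnifDiagLimit (fun h t => h * p10 F (t + h) t / F (t + h) t) (-ρ) ∧
  UnifDiagLimit (fun h t => h ^ 2 * p11 F t (t - h) / F t (t - h)) (ρ * (ρ - 1)) ∧
  UnifDiagLimit (fun h t => h ^ 2 * p02 F t (t - h) / F t (t - h)) (-(ρ * (ρ - 1)))

open scoped Topology

section Partials

variable {G : ℝ × ℝ → ℝ} {U : Set (ℝ × ℝ)} {n : WithTop ℕ∞}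

lemma hasDerivAt_snd_fderiv (hU : IsOpen U) (hG : ContDiffOn ℝ (n + 1) G U) {t r : ℝ}
    (h : (t, r) ∈ U) : HasDerivAt (fun x => G (t, x)) (fderiv ℝ G (t, r) (0, 1)) r := by
  have hd : DifferentiableAt ℝ G (t, r) :=
    (hG.contDiffAt (hU.mem_nhds h)).differentiableAt (by simp)
  exact hd.hasFDerivAt.comp_hasDerivAt (f := fun x => (t, x)) r
    ((hasDerivAt_const r t).prodMk (hasDerivAt_id r))

lemma hasDerivAt_fst_fderiv (hU : IsOpen U) (hG : ContDiffOn ℝ (n + 1) G U) {t r : ℝ}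
    (h : (t, r) ∈ U) : HasDerivAt (fun x => G (x, r)) (fderiv ℝ G (t, r) (1, 0)) t := by
  have hd : DifferentiableAt ℝ G (t, r) :=
    (hG.contDiffAt (hU.mem_nhds h)).differentiableAt (by simp)
  exact hd.hasFDerivAt.comp_hasDerivAt (f := fun x => (x, r)) t
    ((hasDerivAt_id t).prodMk (hasDerivAt_const t r))

lemma contDiffOn_deriv_snd (hU : IsOpen U) (hG : ContDiffOn ℝ (n + 1) G U) :
    ContDiffOn ℝ n (fun p : ℝ × ℝ => deriv (fun x => G (p.1, x)) p.2) U :=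
  ((hG.fderiv_of_isOpen hU le_rfl).clm_apply contDiffOn_const).congr
    fun _ hp => (hasDerivAt_snd_fderiv hU hG hp).deriv

lemma contDiffOn_deriv_fst (hU : IsOpen U) (hG : ContDiffOn ℝ (n + 1) G U) :
    ContDiffOn ℝ n (fun p : ℝ × ℝ => deriv (fun x => G (x, p.2)) p.1) U :=
  ((hG.fderiv_of_isOpen hU le_rfl).clm_apply contDiffOn_const).congr
    fun _ hp => (hasDerivAt_fst_fderiv hU hG hp).deriv

end Partials

lemma isOpen_lowerTriangle : IsOpen {p : ℝ × ℝ | p.2 < p.1} :=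
  isOpen_lt continuous_snd continuous_fst

namespace SmoothVar

variable {F : ℝ → ℝ → ℝ} {ρ : ℝ}

lemma contDiffOn (hF : SmoothVar F ρ) :
    ContDiffOn ℝ (1 + 1) (fun p : ℝ × ℝ => F p.1 p.2) {p : ℝ × ℝ | p.2 < p.1} := by
  rw [one_add_one_eq_two]
  exact hF.2.1

lemma contDiffOn_p01 (hF : SmoothVar F ρ) :
    ContDiffOn ℝ (0 + 1) (fun p : ℝ × ℝ => p01 F p.1 p.2) {p : ℝ × ℝ | p.2 < p.1} := by
  rw [zero_add]
  exact contDiffOn_deriv_snd isOpen_lowerTriangle hF.contDiffOn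

lemma continuousOn_p11 (hF : SmoothVar F ρ) :
    ContinuousOn (fun p : ℝ × ℝ => p11 F p.1 p.2) {p : ℝ × ℝ | p.2 < p.1} :=
  (contDiffOn_deriv_fst isOpen_lowerTriangle hF.contDiffOn_p01).continuousOn

lemma hasDerivAt_p01 (hF : SmoothVar F ρ) {t r : ℝ} (h : r < t) :
    HasDerivAt (F t) (p01 F t r) r :=
  (hasDerivAt_snd_fderiv isOpen_lowerTriangle hF.contDiffOn
    (show (t, r) ∈ _ from h)).differentiableAt.hasDerivAt

lemma hasDerivAt_p10 (hF : SmoothVar F ρ) {t r : ℝ} (h : r < t) :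
    HasDerivAt (fun x => F x r) (p10 F t r) t :=
  (hasDerivAt_fst_fderiv isOpen_lowerTriangle hF.contDiffOn
    (show (t, r) ∈ _ from h)).differentiableAt.hasDerivAt

lemma hasDerivAt_p11 (hF : SmoothVar F ρ) {t r : ℝ} (h : r < t) :
    HasDerivAt (fun x => p01 F x r) (p11 F t r) t :=
  (hasDerivAt_fst_fderiv isOpen_lowerTriangle hF.contDiffOn_p01
    (show (t, r) ∈ _ from h)).differentiableAt.hasDerivAt

lemma continuousOn_p01_right (hF : SmoothVar F ρ) {t a b : ℝ} (h : b < t) :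
    ContinuousOn (p01 F t) (Set.Icc a b) :=
  hF.contDiffOn_p01.continuousOn.comp (f := fun x => (t, x)) (by fun_prop)
    fun _ hx => lt_of_le_of_lt hx.2 h

lemma continuousOn_right (hF : SmoothVar F ρ) (t : ℝ) : ContinuousOn (F t) (Set.Iic t) :=
  hF.1.comp (f := fun x => (t, x)) (by fun_prop) fun _ hx => hx

end SmoothVar

/-- A Grönwall-type comparison with powers: if `h` times the derivative of `φ` is at least `a φ(h)`,
then `φ(h) h⁻ᵃ` is monotone. -/
lemma monotoneOn_mul_rpow_neg {φ φ' : ℝ → ℝ} {a h₀ : ℝ}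
    (hφ : ∀ h ∈ Set.Ioo 0 h₀, HasDerivAt φ (φ' h) h)
    (hle : ∀ h ∈ Set.Ioo 0 h₀, a * φ h ≤ h * φ' h) :
    MonotoneOn (fun h => φ h * h ^ (-a)) (Set.Ioo 0 h₀) := by
  have hd : ∀ h ∈ Set.Ioo 0 h₀, HasDerivAt (fun h => φ h * h ^ (-a))
      (φ' h * h ^ (-a) + φ h * (1 * (-a) * h ^ (-a - 1))) h := fun h hh =>
    (hφ h hh).mul ((hasDerivAt_id h).rpow_const (Or.inl hh.1.ne'))
  refine monotoneOn_of_deriv_nonneg (convex_Ioo _ _)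
    (fun h hh => (hd h hh).continuousAt.continuousWithinAt)
    (fun h hh => (hd h (interior_subset hh)).differentiableAt.differentiableWithinAt) ?_
  intro h hh
  replace hh := interior_subset hh
  rw [(hd h hh).deriv]
  have hs : h ^ (-a) = h * h ^ (-a - 1) := by
    rw [Real.rpow_sub_one hh.1.ne', mul_div_cancel₀ _ hh.1.ne']
  have hp : 0 < h ^ (-a - 1) := Real.rpow_pos_of_pos hh.1 _
  rw [hs]
  nlinarith [hle h hh]

lemma eventually_le_mul_rpow {φ φ' : ℝ → ℝ} {a h₀ : ℝ} (hh₀ : 0 < h₀)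
    (hφ : ∀ h ∈ Set.Ioo 0 h₀, HasDerivAt φ (φ' h) h)
    (hle : ∀ h ∈ Set.Ioo 0 h₀, a * φ h ≤ h * φ' h) :
    ∀ᶠ h in 𝓝[>] 0, φ h ≤ φ (h₀ / 2) * (h₀ / 2) ^ (-a) * h ^ a := by
  filter_upwards [Ioo_mem_nhdsGT (half_pos hh₀)] with h hh
  have hm := monotoneOn_mul_rpow_neg hφ hle ⟨hh.1, by linarith [hh.2]⟩
    ⟨half_pos hh₀, by linarith⟩ hh.2.le
  have hp : 0 < h ^ a := Real.rpow_pos_of_pos hh.1 _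
  calc φ h = φ h * h ^ (-a) * h ^ a := by
        rw [mul_assoc, ← Real.rpow_add hh.1]; simp
    _ ≤ _ := by gcongr

/-- A right-continuous real function is measurable. -/
lemma measurable_of_rightContinuous {X : ℝ → ℝ}
    (hX : ∀ s : ℝ, Tendsto X (𝓝[≥] s) (𝓝 (X s))) : Measurable X := by
  have hlim : ∀ s : ℝ, Tendsto (fun n : ℕ => ((⌊s * (n + 1)⌋ : ℝ) + 1) / (n + 1)) atTop
      (𝓝[≥] s) := by
    intro s
    refine tendsto_nhdsWithin_iff.2 ⟨?_, .of_forall fun n => ?_⟩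
    · have h1 : Tendsto (fun n : ℕ => s + 1 / ((n : ℝ) + 1)) atTop (𝓝 s) := by
        simpa using tendsto_one_div_add_atTop_nhds_zero_nat.const_add s
      refine tendsto_of_tendsto_of_tendsto_of_le_of_le tendsto_const_nhds h1 (fun n => ?_)
        fun n => ?_
      · have := Int.lt_floor_add_one (s * (n + 1))
        exact (le_div_iff₀ (by positivity)).2 this.le
      · have := Int.floor_le (s * ((n : ℝ) + 1))
        have hn : (0 : ℝ) < n + 1 := by positivity
        change _ / _ ≤ _
        rw [div_le_iff₀ hn, add_mul, one_div, inv_mul_cancel₀ hn.ne']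
        linarith
    · have := Int.lt_floor_add_one (s * (n + 1))
      exact (le_div_iff₀ (by positivity)).2 this.le
  refine measurable_of_tendsto_metrizable
    (f := fun (n : ℕ) (s : ℝ) => X (((⌊s * (n + 1)⌋ : ℝ) + 1) / (n + 1))) (fun n => ?_)
    (tendsto_pi_nhds.2 fun s => (hX s).comp (hlim s))
  exact (Measurable.of_discrete (f := fun k : ℤ => X (((k : ℝ) + 1) / (n + 1)))).comp
    (Int.measurable_floor.comp (measurable_id.mul_const ((n : ℝ) + 1)))

namespace SmoothVar

variable {F : ℝ → ℝ → ℝ} {ρ : ℝ}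

lemma diag_eq_zero (hF : SmoothVar F ρ) (hρ : 0 < ρ) (t : ℝ) : F t t = 0 := by
  obtain ⟨h₀, hh₀, hlt⟩ := hF.2.2.2.1 {t} isCompact_singleton (ρ / 2) (by positivity)
  have hpos := hF.2.2.1
  have hcont : Tendsto (fun h => F t (t - h)) (𝓝[>] 0) (𝓝 (F t t)) := by
    refine (hF.continuousOn_right t t self_mem_Iic).tendsto.comp
      (tendsto_nhdsWithin_iff.2 ⟨?_, ?_⟩)
    · refine Tendsto.mono_left ?_ nhdsWithin_le_nhds
      exact (continuous_const.sub continuous_id).tendsto' _ _ (sub_zero t)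
    · filter_upwards [self_mem_nhdsWithin] with h hh
      exact sub_le_self t (le_of_lt hh)
  have hbound := eventually_le_mul_rpow (φ := fun h => F t (t - h))
    (φ' := fun h => -p01 F t (t - h)) (a := ρ / 2) hh₀ (fun h hh => ?_) fun h hh => ?_
  · have hpow : Tendsto (fun h : ℝ => F t (t - h₀ / 2) * (h₀ / 2) ^ (-(ρ / 2)) * h ^ (ρ / 2))
        (𝓝[>] 0) (𝓝 0) := by
      have := (Real.continuousAt_rpow_const 0 (ρ / 2) (Or.inr (by positivity))).tendsto
      rw [Real.zero_rpow (by positivity)] at this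
      simpa using (this.mono_left nhdsWithin_le_nhds).const_mul
        (F t (t - h₀ / 2) * (h₀ / 2) ^ (-(ρ / 2)))
    refine le_antisymm (le_of_tendsto_of_tendsto hcont hpow hbound) (ge_of_tendsto hcont ?_)
    filter_upwards [self_mem_nhdsWithin] with h hh
    exact (hpos t (t - h) (sub_lt_self t hh)).le
  · exact (hF.hasDerivAt_p01 (sub_lt_self t hh.1)).comp_const_sub t h
  · have hp := hpos t (t - h) (sub_lt_self t hh.1)
    have := (abs_lt.1 (hlt h hh.1 hh.2 t rfl)).2
    have h2 : h * p01 F t (t - h) / F t (t - h) < -(ρ / 2) := by linarith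
    rw [div_lt_iff₀ hp] at h2
    linarith

lemma tendsto_div_zero (hF : SmoothVar F ρ) (hρ : ρ < 1) (t : ℝ) :
    Tendsto (fun h => h / F (t + h) t) (𝓝[>] 0) (𝓝 0) := by
  obtain ⟨h₀, hh₀, hlt⟩ := hF.2.2.2.2.1 {t} isCompact_singleton ((1 - ρ) / 2) (by linarith)
  have hpos := hF.2.2.1
  set a := (1 + ρ) / 2 with ha
  have hbound := eventually_le_mul_rpow (φ := fun h => -F (t + h) t)
    (φ' := fun h => -p10 F (t + h) t) (a := a) hh₀ (fun h hh => ?_) fun h hh => ?_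
  · obtain ⟨c, hc⟩ : ∃ c, c = F (t + h₀ / 2) t * (h₀ / 2) ^ (-a) := ⟨_, rfl⟩
    have hcpos : 0 < c := hc ▸ mul_pos (hpos _ _ (by linarith))
      (Real.rpow_pos_of_pos (by linarith) _)
    have hpow : Tendsto (fun h : ℝ => h ^ (1 - a) / c) (𝓝[>] 0) (𝓝 0) := by
      have := (Real.continuousAt_rpow_const 0 (1 - a) (Or.inr (by linarith))).tendsto
      rw [Real.zero_rpow (by linarith)] at this
      simpa using (this.mono_left nhdsWithin_le_nhds).div_const c
    refine squeeze_zero' ?_ ?_ hpow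
    · filter_upwards [self_mem_nhdsWithin] with h hh
      exact div_nonneg (le_of_lt hh) (hpos _ _ (lt_add_of_pos_right t hh)).le
    · filter_upwards [self_mem_nhdsWithin, hbound] with h hh hb
      have hh' : 0 < h := hh
      rw [div_le_div_iff₀ (hpos _ _ (lt_add_of_pos_right t hh)) hcpos]
      have hb' : c * h ^ a ≤ F (t + h) t := by simp only [neg_mul] at hb; rw [hc]; linarith
      have hsplit : h ^ (1 - a) * h ^ a = h := by
        rw [← Real.rpow_add hh']; simp
      calc h * c = h ^ (1 - a) * (c * h ^ a) := by
            rw [mul_left_comm, hsplit, mul_comm c]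
        _ ≤ _ := by gcongr
  · exact ((hF.hasDerivAt_p10 (lt_add_of_pos_right t hh.1)).comp_const_add t h).neg
  · have hp := hpos (t + h) t (lt_add_of_pos_right t hh.1)
    have := (abs_lt.1 (hlt h hh.1 hh.2 t rfl)).2
    have h2 : h * p10 F (t + h) t / F (t + h) t < a := by linarith
    rw [div_lt_iff₀ hp] at h2
    linarith

lemma tendsto_div_mul_p01 (hF : SmoothVar F ρ) (hρ : 0 < ρ) (t : ℝ) :
    Tendsto (fun h => F (t + h) t / (h * p01 F (t + h) t)) (𝓝[>] 0) (𝓝 (-(1 / ρ))) := by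
  have h1 : Tendsto (fun h => h * p01 F (t + h) t / F (t + h) t) (𝓝[>] 0) (𝓝 (-ρ)) := by
    rw [Metric.tendsto_nhds]
    intro ε hε
    obtain ⟨h₀, hh₀, hlt⟩ := hF.2.2.2.1 (Set.Icc t (t + 1)) isCompact_Icc ε hε
    filter_upwards [Ioo_mem_nhdsGT hh₀, Ioo_mem_nhdsGT one_pos] with h hh hh1
    have := hlt h hh.1 hh.2 (t + h) ⟨by linarith [hh.1], by linarith [hh1.2]⟩
    simpa [Real.dist_eq] using this
  have h2 := h1.inv₀ (neg_ne_zero.2 hρ.ne')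
  simpa [inv_neg] using h2

lemma exists_sign_near_diag (hF : SmoothVar F ρ) (hρ : ρ ∈ Set.Ioo (0 : ℝ) 1) (t : ℝ) :
    ∃ h₀ > 0, ∀ u ∈ Set.Icc t (t + 1), ∀ s, s < u → u - s < h₀ →
      p01 F u s ≤ 0 ∧ 0 ≤ p11 F u s := by
  obtain ⟨hρ0, hρ1⟩ := hρ
  have hρρ : 0 < ρ * (1 - ρ) := mul_pos hρ0 (by linarith)
  obtain ⟨h₁, hh₁, hlt₁⟩ := hF.2.2.2.1 (Set.Icc t (t + 1)) isCompact_Icc ρ hρ0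
  obtain ⟨h₂, hh₂, hlt₂⟩ := hF.2.2.2.2.2.1 (Set.Icc t (t + 1)) isCompact_Icc _ hρρ
  refine ⟨min h₁ h₂, lt_min hh₁ hh₂, fun u hu s hs hlt => ?_⟩
  have hp := hF.2.2.1 u s hs
  have hus : 0 < u - s := sub_pos.2 hs
  have e₁ := (abs_lt.1 (hlt₁ (u - s) hus (hlt.trans_le (min_le_left _ _)) u hu)).2
  have e₂ := (abs_lt.1 (hlt₂ (u - s) hus (hlt.trans_le (min_le_right _ _)) u hu)).1
  simp only [sub_sub_cancel] at e₁ e₂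
  constructor
  · by_contra! hcon
    have : 0 < (u - s) * p01 F u s / F u s := by positivity
    linarith
  · by_contra! hcon
    have : (u - s) ^ 2 * p11 F u s / F u s < 0 :=
      div_neg_of_neg_of_pos (mul_neg_of_pos_of_neg (by positivity) hcon) hp
    linarith

lemma intervalIntegrable_p01 (hF : SmoothVar F ρ) {a b u : ℝ} (hab : a ≤ b) (hbu : b ≤ u)
    (hneg : ∀ s ∈ Set.Ioo a b, p01 F u s ≤ 0) : IntervalIntegrable (p01 F u) volume a b := by
  have hc : ContinuousOn (F u) (Set.Icc a b) :=
    (hF.continuousOn_right u).mono fun s hs => hs.2.trans hbu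
  have := integrableOn_deriv_of_nonneg hc.neg
    (fun s hs => (hF.hasDerivAt_p01 (hs.2.trans_le hbu)).neg)
    fun s hs => neg_nonneg.2 (hneg s hs)
  rw [intervalIntegrable_iff_integrableOn_Ioc_of_le hab]
  simpa using this.neg

lemma integral_p01 (hF : SmoothVar F ρ) {a b u : ℝ} (hab : a ≤ b) (hbu : b ≤ u)
    (hneg : ∀ s ∈ Set.Ioo a b, p01 F u s ≤ 0) :
    ∫ s in a..b, p01 F u s = F u b - F u a :=
  integral_eq_sub_of_hasDerivAt_of_le hab
    ((hF.continuousOn_right u).mono fun _ hs => hs.2.trans hbu)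
    (fun _ hs => hF.hasDerivAt_p01 (hs.2.trans_le hbu))
    (hF.intervalIntegrable_p01 hab hbu hneg)

lemma p01_le_p01 (hF : SmoothVar F ρ) {s u v : ℝ} (hs : s < u) (huv : u ≤ v)
    (hnonneg : ∀ x ∈ Set.Icc u v, 0 ≤ p11 F x s) : p01 F u s ≤ p01 F v s := by
  have hd : ∀ x ∈ Set.Icc u v, HasDerivAt (fun x => p01 F x s) (p11 F x s) x := fun x hx =>
    hF.hasDerivAt_p11 (hs.trans_le hx.1)
  refine monotoneOn_of_deriv_nonneg (convex_Icc u v)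
    (fun x hx => (hd x hx).continuousAt.continuousWithinAt)
    (fun x hx => (hd x (interior_subset hx)).differentiableAt.differentiableWithinAt)
    (fun x hx => ?_) (Set.left_mem_Icc.2 huv) (Set.right_mem_Icc.2 huv) huv
  rw [(hd x (interior_subset hx)).deriv]
  exact hnonneg x (interior_subset hx)

/-- Away from the diagonal, `p01 F` is Lipschitz in its first variable. -/
lemma exists_abs_p01_sub_le (hF : SmoothVar F ρ) {a b t : ℝ} (hb : b < t) :
    ∃ C ≥ 0, ∀ δ ∈ Set.Ioo (0 : ℝ) 1, ∀ s ∈ Set.Icc a b,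
      |p01 F (t + δ) s - p01 F t s| ≤ C * δ := by
  have hsub : Set.Icc t (t + 1) ×ˢ Set.Icc a b ⊆ {p : ℝ × ℝ | p.2 < p.1} :=
    fun p hp => (hp.2.2.trans_lt hb).trans_le hp.1.1
  obtain ⟨C, hC⟩ := (isCompact_Icc.prod isCompact_Icc).exists_bound_of_continuousOn
    (hF.continuousOn_p11.mono hsub)
  refine ⟨max C 0, le_max_right _ _, fun δ hδ s hs => ?_⟩
  have := (convex_Icc t (t + 1)).norm_image_sub_le_of_norm_hasDerivWithin_le
    (f := fun x => p01 F x s) (x := t) (y := t + δ)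
    (fun x hx => (hF.hasDerivAt_p11 ((hs.2.trans_lt hb).trans_le hx.1)).hasDerivWithinAt)
    (fun x hx => (hC (x, s) ⟨hx, hs⟩).trans (le_max_left _ 0))
    ⟨le_rfl, by linarith⟩ ⟨by linarith [hδ.1], by linarith [hδ.2]⟩
  simpa [abs_of_pos hδ.1] using this

lemma exists_abs_sub_le (hF : SmoothVar F ρ) {r t : ℝ} (hr : r < t) :
    ∃ C ≥ 0, ∀ᶠ δ in 𝓝[>] (0 : ℝ), |F (t + δ) r - F t r| ≤ C * δ := by
  obtain ⟨C, hC, hO⟩ := (hF.hasDerivAt_p10 hr).isBigO_sub.exists_nonneg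
  refine ⟨C, hC, ?_⟩
  have htend : Tendsto (fun δ : ℝ => t + δ) (𝓝[>] 0) (𝓝 t) :=
    ((continuous_const.add continuous_id).tendsto' _ _ (add_zero t)).mono_left
      nhdsWithin_le_nhds
  filter_upwards [htend.eventually hO.bound, self_mem_nhdsWithin] with δ h hδ
  simpa [abs_of_pos (show 0 < δ from hδ)] using h

end SmoothVar

/-- An averaging estimate: if the kernel `D` is at most `K` on `(a, r]` and nonnegative on `(r, t)`,
where `X` is `ε`-close to `x`, then `∫ D X` over `[a, t]` is close to `x ∫ D` over `[r, t]`. -/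
lemma abs_integral_mul_sub_le {D X : ℝ → ℝ} {a r t x ε K M : ℝ} (har : a ≤ r) (hrt : r ≤ t)
    (hD₁ : IntervalIntegrable D volume a r) (hD₂ : IntervalIntegrable D volume r t)
    (hX : Measurable X) (hM : ∀ s ∈ Set.Icc a t, |X s| ≤ M) (hK0 : 0 ≤ K)
    (hK : ∀ s ∈ Set.Ioc a r, |D s| ≤ K) (hpos : ∀ s ∈ Set.Ioo r t, 0 ≤ D s)
    (hx : ∀ s ∈ Set.Ioo r t, |X s - x| ≤ ε) :
    |(∫ s in a..t, D s * X s) - x * ∫ s in r..t, D s|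
      ≤ K * M * (r - a) + ε * ∫ s in r..t, D s := by
  have hint : ∀ {b c}, a ≤ b → b ≤ c → c ≤ t → IntervalIntegrable D volume b c →
      IntervalIntegrable (fun s => D s * X s) volume b c := by
    intro b c hb hbc hc h
    rw [intervalIntegrable_iff_integrableOn_Ioc_of_le hbc] at h ⊢
    refine Integrable.mul_bdd (c := M) h hX.aestronglyMeasurable ?_
    filter_upwards [ae_restrict_mem measurableSet_Ioc] with s hs
    exact hM s ⟨hb.trans hs.1.le, hs.2.trans hc⟩
  have hDX₁ := hint le_rfl har hrt hD₁
  have hDX₂ := hint har hrt le_rfl hD₂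
  have hfar : |∫ s in a..r, D s * X s| ≤ K * M * (r - a) := by
    rw [← abs_of_nonneg (sub_nonneg.2 har), ← Real.norm_eq_abs]
    refine intervalIntegral.norm_integral_le_of_norm_le_const fun s hs => ?_
    rw [Set.uIoc_of_le har] at hs
    rw [Real.norm_eq_abs, abs_mul]
    exact mul_le_mul (hK s hs) (hM s ⟨hs.1.le, hs.2.trans hrt⟩) (abs_nonneg _) hK0
  have hnear : |∫ s in r..t, (D s * X s - x * D s)| ≤ ∫ s in r..t, ε * D s := by
    rw [← Real.norm_eq_abs]
    refine intervalIntegral.norm_integral_le_of_norm_le hrt ?_ (hD₂.const_mul ε)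
    filter_upwards [Measure.ae_ne volume t] with s hst hs
    have hs' : s ∈ Set.Ioo r t := ⟨hs.1, lt_of_le_of_ne hs.2 hst⟩
    rw [show D s * X s - x * D s = (X s - x) * D s by ring, Real.norm_eq_abs, abs_mul,
      abs_of_nonneg (hpos s hs')]
    exact mul_le_mul_of_nonneg_right (hx s hs') (hpos s hs')
  rw [intervalIntegral.integral_sub hDX₂ (hD₂.const_mul x), intervalIntegral.integral_const_mul,
    intervalIntegral.integral_const_mul] at hnear
  rw [← integral_add_adjacent_intervals hDX₁ hDX₂, add_sub_assoc]
  exact (abs_add_le _ _).trans (add_le_add hfar hnear)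

/-- Convergence of the backward average of `X`, written as an integral over `[0, t]`. -/
lemma SmoothVar.eventually_abs_integral_lt {F : ℝ → ℝ → ℝ} {d : ℝ} (hF : SmoothVar F d)
    (hd : d ∈ Set.Ioo (0 : ℝ) 1) {X : ℝ → ℝ} (hX : Measurable X) {t x M : ℝ} (ht : 0 < t)
    (hx : Tendsto X (𝓝[<] t) (𝓝 x)) (hM : ∀ s ∈ Set.Icc 0 t, |X s| ≤ M) {ε : ℝ} (hε : 0 < ε) :
    ∀ᶠ δ in 𝓝[>] (0 : ℝ),
      |(∫ s in (0 : ℝ)..t, (p01 F (t + δ) s - p01 F t s) * X s) / (δ * p01 F (t + δ) t)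
        + 1 / d * x| < ε := by
  have hd0 := hd.1
  have hε' : 0 < ε * d / 2 := by positivity
  obtain ⟨h₀, hh₀, hsign⟩ := hF.exists_sign_near_diag hd t
  obtain ⟨l, hl, hXl⟩ := mem_nhdsLT_iff_exists_Ioo_subset.1
    (Metric.tendsto_nhds.1 hx _ hε')
  set r := max (max 0 l) (t - h₀ / 2)
  have hrt : r < t := max_lt (max_lt ht hl) (by linarith)
  have hr0 : 0 ≤ r := (le_max_left 0 l).trans (le_max_left _ _)
  have hlr : l ≤ r := (le_max_right 0 l).trans (le_max_left _ _)
  have hrh : t - h₀ / 2 ≤ r := le_max_right _ _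
  obtain ⟨C₁, hC₁, hfar⟩ := hF.exists_abs_p01_sub_le (a := 0) hrt
  obtain ⟨C₂, hC₂, hincr⟩ := hF.exists_abs_sub_le hrt
  have hq := hF.tendsto_div_mul_p01 hd0 t
  have hw : Tendsto (fun δ => δ / (δ * p01 F (t + δ) t)) (𝓝[>] 0) (𝓝 0) := by
    have h := (hF.tendsto_div_zero hd.2 t).mul hq
    rw [zero_mul] at h
    refine h.congr' ?_
    filter_upwards [self_mem_nhdsWithin] with δ hδ
    have hne := (hF.2.2.1 (t + δ) t (lt_add_of_pos_right t hδ)).ne'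
    rw [div_mul_div_cancel₀ hne]
  have hB : Tendsto (fun δ => C₁ * M * r * |δ / (δ * p01 F (t + δ) t)|
      + ε * d / 2 * (|F (t + δ) t / (δ * p01 F (t + δ) t)|
        + C₂ * |δ / (δ * p01 F (t + δ) t)|)
      + |x| * (|F (t + δ) t / (δ * p01 F (t + δ) t) + 1 / d|
        + C₂ * |δ / (δ * p01 F (t + δ) t)|)) (𝓝[>] 0) (𝓝 (ε / 2)) := by
    have h := ((hw.abs.const_mul (C₁ * M * r)).add
      ((hq.abs.add (hw.abs.const_mul C₂)).const_mul (ε * d / 2))).add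
      (((hq.add_const (1 / d)).abs.add (hw.abs.const_mul C₂)).const_mul |x|)
    refine h.trans_eq ?_
    congr 1
    rw [abs_neg, abs_of_pos (one_div_pos.2 hd0)]
    simp
    field_simp
  filter_upwards [hB.eventually (gt_mem_nhds (half_lt_self hε)), hincr,
    Ioo_mem_nhdsGT one_pos, Ioo_mem_nhdsGT (half_pos hh₀)] with δ hBδ hR hδ1 hδh
  refine lt_of_le_of_lt ?_ hBδ
  have hδ := hδ1.1
  have hneg : ∀ u ∈ Set.Icc t (t + δ), ∀ s ∈ Set.Ioo r t, p01 F u s ≤ 0 ∧ 0 ≤ p11 F u s :=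
    fun u hu s hs => hsign u ⟨hu.1, hu.2.trans (by linarith [hδ1.2])⟩ s (hs.2.trans_le hu.1)
      (by linarith [hu.2, hs.1, hδh.2])
  have htδ : t ≤ t + δ := by linarith
  have hi₁ := hF.intervalIntegrable_p01 hrt.le htδ
    fun s hs => (hneg (t + δ) ⟨htδ, le_rfl⟩ s hs).1
  have hi₂ := hF.intervalIntegrable_p01 hrt.le le_rfl
    fun s hs => (hneg t ⟨le_rfl, htδ⟩ s hs).1
  have hI : ∫ s in r..t, (p01 F (t + δ) s - p01 F t s)
      = F (t + δ) t - (F (t + δ) r - F t r) := by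
    rw [intervalIntegral.integral_sub hi₁ hi₂,
      hF.integral_p01 hrt.le htδ fun s hs => (hneg (t + δ) ⟨htδ, le_rfl⟩ s hs).1,
      hF.integral_p01 hrt.le le_rfl fun s hs => (hneg t ⟨le_rfl, htδ⟩ s hs).1,
      hF.diag_eq_zero hd0 t]
    ring
  have hJ := abs_integral_mul_sub_le (D := fun s => p01 F (t + δ) s - p01 F t s) hr0 hrt.le
    (((hF.continuousOn_p01_right (hrt.trans_le htδ)).sub
      (hF.continuousOn_p01_right hrt)).intervalIntegrable_of_Icc hr0)
    (hi₁.sub hi₂) hX hM (mul_nonneg hC₁ hδ.le)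
    (fun s hs => hfar δ hδ1 s (Set.Ioc_subset_Icc_self hs))
    (fun s hs => sub_nonneg.2 (hF.p01_le_p01 hs.2 htδ fun u hu => (hneg u hu s hs).2))
    (fun s hs => (hXl ⟨hlr.trans_lt hs.1, hs.2⟩ : dist (X s) x < ε * d / 2).le)
  rw [hI, sub_zero] at hJ
  generalize (∫ s in (0 : ℝ)..t, (p01 F (t + δ) s - p01 F t s) * X s) = J at hJ ⊢
  generalize F (t + δ) r - F t r = R at hR hJ
  generalize F (t + δ) t = Φ at hJ ⊢
  generalize δ * p01 F (t + δ) t = A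
  have hRA : |R / A| ≤ C₂ * |δ / A| := by
    rw [abs_div, abs_div, abs_of_pos hδ, ← mul_div_assoc]
    gcongr
  have hΦ : Φ / |A| ≤ |Φ / A| := by
    rw [abs_div]
    gcongr
    exact le_abs_self Φ
  have hRA' : -(R / |A|) ≤ C₂ * |δ / A| := by
    refine le_trans ?_ hRA
    rw [abs_div, ← neg_div]
    gcongr
    exact neg_le_abs R
  have hmain : |(J - x * (Φ - R)) / A| ≤ C₁ * M * r * |δ / A|
      + ε * d / 2 * (|Φ / A| + C₂ * |δ / A|) := by
    rw [abs_div (J - _)]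
    calc |J - x * (Φ - R)| / |A| ≤ (C₁ * δ * M * r + ε * d / 2 * (Φ - R)) / |A| := by gcongr
      _ = C₁ * M * r * |δ / A| + ε * d / 2 * (Φ / |A| + -(R / |A|)) := by
        rw [abs_div, abs_of_pos hδ]; ring
      _ ≤ _ := by gcongr
  have hlimit : |x * ((Φ / A + 1 / d) - R / A)| ≤ |x| * (|Φ / A + 1 / d| + C₂ * |δ / A|) := by
    rw [abs_mul]
    gcongr
    exact (abs_sub _ _).trans (add_le_add le_rfl hRA)
  calc |J / A + 1 / d * x| = |(J - x * (Φ - R)) / A + x * ((Φ / A + 1 / d) - R / A)| := by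
        congr 1; ring
    _ ≤ _ := (abs_add_le _ _).trans (add_le_add hmain hlimit)

/-- Proposition 1, pathwise: for a càdlàg path `X` with left-limit
function `Xm`, `X(0) = X(0−) = 0`, bounded on `[0,1]`:
`lim_{δ↓0} |∫₀^{t/δ} g_δ(t,v) X(t−δv) dv + (1/d) X(t−)| = 0` for every `t ∈ [0,1]`. -/
theorem proposition1 (d : ℝ) (hd : d ∈ Set.Ioo (0:ℝ) 1)
    (F : ℝ → ℝ → ℝ) (hF : SmoothVar F d)
    (f : ℝ → ℝ → ℝ) (hf : ∀ t r : ℝ, f t r = p01 F t r)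
    (X Xm : ℝ → ℝ)
    (hXrc : ∀ s : ℝ, Tendsto X (nhdsWithin s (Set.Ici s)) (nhds (X s)))
    (hXll : ∀ s : ℝ, Tendsto X (nhdsWithin s (Set.Iio s)) (nhds (Xm s)))
    (hX0 : X 0 = 0) (hXm0 : Xm 0 = 0)
    (hXbdd : ∃ C : ℝ, ∀ s ∈ Set.Icc (0:ℝ) 1, |X s| ≤ C) :
    ∀ t ∈ Set.Icc (0:ℝ) 1, ∀ ε > (0:ℝ), ∃ δ₀ > (0:ℝ), ∀ δ : ℝ, 0 < δ → δ < δ₀ →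
      |(∫ v in (0:ℝ)..(t / δ),
          ((f (t + δ) (t - δ * v) - f t (t - δ * v)) / f (t + δ) t) * X (t - δ * v))
        + (1 / d) * Xm t| < ε := by
  intro t ht ε hε
  obtain ⟨C, hC⟩ := hXbdd
  obtain rfl | ht0 := ht.1.eq_or_lt
  · exact ⟨1, one_pos, fun δ _ _ => by simpa [hXm0] using hε⟩
  have hev := hF.eventually_abs_integral_lt hd (measurable_of_rightContinuous hXrc) ht0 (hXll t)
    (fun s hs => hC s ⟨hs.1, hs.2.trans ht.2⟩) hε
  obtain ⟨δ₀, hδ₀, hsub⟩ := mem_nhdsGT_iff_exists_Ioo_subset.1 hev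
  refine ⟨δ₀, hδ₀, fun δ hδ hlt => ?_⟩
  have h : |_ / _ + _| < ε := hsub ⟨hδ, hlt⟩
  convert h using 3
  simp only [hf]
  rw [intervalIntegral.integral_comp_sub_mul
    (fun s => (p01 F (t + δ) s - p01 F t s) / p01 F (t + δ) t * X s) hδ.ne' t,
    mul_div_cancel₀ t hδ.ne', sub_self, mul_zero, sub_zero]
  simp only [div_mul_eq_mul_div]
  rw [intervalIntegral.integral_div, smul_eq_mul, mul_comm δ, ← div_div, inv_mul_eq_div]
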